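/- Let D be a bounded invertible self-adjoint operator and φ a bounded operator on a Hilbert space H such that the commutators [D, φ] and [D², φ] are compact. Then the commutator [D·|D|⁻¹, φ] is compact. -/

import Mathlib

section CompactCommutator

variable {H : Type*} [NormedAddCommGroup H] [InnerProductSpace ℂ H]

/-- The operators commuting with `φ` modulo compacts are closed under multiplication. -/
lemma IsCompactOperator.commutator_mul {a b φ : H →L[ℂ] H}
    (ha : IsCompactOperator (a * φ - φ * a : H →L[ℂ] H))
    (hb : IsCompactOperator (b * φ - φ * b : H →L[ℂ] H)) :
    IsCompactOperator (a * b * φ - φ * (a * b) : H →L[ℂ] H) := by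
  have h : a * b * φ - φ * (a * b) = a * (b * φ - φ * b) + (a * φ - φ * a) * b := by
    noncomm_ring
  rw [h]
  exact (hb.clm_comp a).add (ha.comp_clm b)

/-- The operators commuting with `φ` modulo compacts are closed under `Ring.inverse`. -/
lemma IsCompactOperator.commutator_ringInverse {a φ : H →L[ℂ] H}
    (ha : IsCompactOperator (a * φ - φ * a : H →L[ℂ] H)) :
    IsCompactOperator (Ring.inverse a * φ - φ * Ring.inverse a : H →L[ℂ] H) := by
  by_cases hu : IsUnit a
  · have h : Ring.inverse a * φ - φ * Ring.inverse a
        = -(Ring.inverse a * ((a * φ - φ * a) * Ring.inverse a)) := by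
      have h₁ := Ring.inverse_mul_cancel a hu
      have h₂ := Ring.mul_inverse_cancel a hu
      rw [sub_mul, mul_sub, mul_assoc φ a, h₂, mul_one, mul_assoc a φ, ← mul_assoc _ a, h₁,
        one_mul, neg_sub]
    rw [h]
    exact ((ha.comp_clm (Ring.inverse a)).clm_comp (Ring.inverse a)).neg
  · rw [Ring.inverse_non_unit a hu, zero_mul, mul_zero, sub_zero]
    exact isCompactOperator_zero

/-- The operators commuting with `φ` modulo compacts form a norm-closed set. -/
lemma isClosed_setOf_isCompactOperator_commutator [CompleteSpace H] (φ : H →L[ℂ] H) :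
    IsClosed {a : H →L[ℂ] H | IsCompactOperator (a * φ - φ * a : H →L[ℂ] H)} :=
  isClosed_setOfPred_isCompactOperator.preimage
    (f := fun a : H →L[ℂ] H => a * φ - φ * a) (by fun_prop)

/-- If a self-adjoint operator commutes with `φ` modulo compacts, so does every element of its
real continuous functional calculus. -/
lemma IsCompactOperator.commutator_cfc [CompleteSpace H] {a φ : H →L[ℂ] H}
    (ha : IsCompactOperator (a * φ - φ * a : H →L[ℂ] H)) (f : ℝ → ℝ) :
    IsCompactOperator (cfc f a * φ - φ * cfc f a : H →L[ℂ] H) := by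
  refine cfc_cases (fun x => IsCompactOperator (x * φ - φ * x : H →L[ℂ] H)) a f ?_ ?_
  · rw [zero_mul, mul_zero, sub_zero]
    exact isCompactOperator_zero
  intro hf hsa
  generalize (⟨_, hf.domRestrict⟩ : C(spectrum ℝ a, ℝ)) = g
  induction g using ContinuousMap.induction_on_of_compact with
  | const r =>
    have h : cfcHom hsa (.const (spectrum ℝ a) r) = algebraMap ℝ (H →L[ℂ] H) r :=
      AlgHomClass.commutes (cfcHom hsa) r
    rw [h, Algebra.commutes r φ, sub_self]
    exact isCompactOperator_zero
  | id => rwa [cfcHom_id hsa]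
  | star_id => rwa [map_star, cfcHom_id, hsa.star_eq]
  | add f g hf hg =>
    rw [map_add, add_mul, mul_add, add_sub_add_comm]
    exact hf.add hg
  | mul f g hf hg =>
    rw [map_mul]
    exact hf.commutator_mul hg
  | frequently f hf =>
    rw [← Set.mem_ofPred_eq (p := fun x : H →L[ℂ] H => IsCompactOperator (x * φ - φ * x)),
      ← (isClosed_setOf_isCompactOperator_commutator φ).closure_eq]
    exact mem_closure_of_frequently_of_tendsto hf ((cfcHom_continuous hsa).tendsto _)

end CompactCommutator


/-- If `D` is a bounded invertible self-adjoint operator and `φ` a bounded operator such that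
`[D, φ]` and `[D², φ]` are compact, then `[D·|D|⁻¹, φ]` is compact. -/
theorem commutator_with_phase_compact
    {H : Type*} [NormedAddCommGroup H] [InnerProductSpace ℂ H] [CompleteSpace H]
    (D : H →L[ℂ] H) (hD : IsSelfAdjoint D) (hDinv : IsUnit D)
    (φ : H →L[ℂ] H)
    (h₁ : IsCompactOperator (D * φ - φ * D : H →L[ℂ] H))
    (h₂ : IsCompactOperator (D * D * φ - φ * (D * D) : H →L[ℂ] H)) :
    IsCompactOperator
      ((D * Ring.inverse (CFC.sqrt (D * D))) * φ - φ * (D * Ring.inverse (CFC.sqrt (D * D)))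
        : H →L[ℂ] H) := by
  have habs : CFC.sqrt (D * D) = cfc (fun x : ℝ => ‖x‖) D := by
    rw [← CFC.abs_eq_cfc_norm D hD, CFC.abs, hD.star_eq]
  rw [habs]
  exact h₁.commutator_mul (h₁.commutator_cfc _).commutator_ringInverse
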